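/- Let k₁, k₂ ≥ 1 and Δ ≥ 0 with 2Δ ≤ k₂. Let s, t ∈ ZMod k₁ × ZMod k₂ be collinear with s₂ = t₂, set Dst := (t₁ − s₁).val, and assume 0 < Dst ≤ ⌊k₁/2⌋. Define the OIDN q := (s₁ + ⌊Dst/2⌋, s₂ + Δ) (the outflank point displaced Δ in the νν dimension above the midpoint of the minimal arc, i.e., λ = (0, 1)). Then D(s, q) + D(q, t) = D(s, t) + 2Δ; i.e., this OIDN has exact additive dilation δ = 2Δ. -/

import Mathlib

/-- Cyclic distance on the ring `ZMod k`. -/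
def cycDist {k : ℕ} (a b : ZMod k) : ℕ := min (a - b).val (b - a).val

/-- Torus distance on the two-dimensional torus. -/
def torusDist2 {k₁ k₂ : ℕ} (s t : ZMod k₁ × ZMod k₂) : ℕ :=
  cycDist s.1 t.1 + cycDist s.2 t.2

theorem cycDist_comm {k : ℕ} (a b : ZMod k) : cycDist a b = cycDist b a :=
  min_comm _ _

theorem cycDist_add_natCast {k n : ℕ} (hk : 1 ≤ k) (hn : 2 * n ≤ k) (a : ZMod k) :
    cycDist a (a + (n : ZMod k)) = n := by
  have : NeZero k := ⟨by omega⟩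
  have hval : (n : ZMod k).val = n := ZMod.val_natCast_of_lt (by omega)
  unfold cycDist
  rw [sub_add_cancel_left, add_sub_cancel_left, ZMod.neg_val, hval]
  split_ifs with h
  · rw [h, ZMod.val_zero] at hval
    omega
  · omega

/-- For collinear `s` and `t`, the OIDN with `λ = (0, 1)` (midpoint of the
minimal arc in the μν dimension, displaced by `Δ` in the νν dimension) has exact
additive dilation `2Δ`. -/
theorem oidn_collinear_mid (k₁ k₂ : ℕ) (hk₁ : 1 ≤ k₁) (hk₂ : 1 ≤ k₂)
    (Δ : ℕ) (hΔ : 2 * Δ ≤ k₂)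
    (s t : ZMod k₁ × ZMod k₂) (hcol : s.2 = t.2)
    (Dst : ℕ) (hDst : Dst = (t.1 - s.1).val)
    (h₀ : 0 < Dst) (h₁ : Dst ≤ k₁ / 2)
    (q : ZMod k₁ × ZMod k₂)
    (hq : q = (s.1 + ((Dst / 2 : ℕ) : ZMod k₁), s.2 + (Δ : ZMod k₂))) :
    torusDist2 s q + torusDist2 q t = torusDist2 s t + 2 * Δ := by
  have : NeZero k₁ := ⟨by omega⟩
  obtain ⟨s₁, s₂⟩ := s
  obtain ⟨t₁, t₂⟩ := t
  dsimp only at hcol hDst hq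
  subst hcol hq
  have ht : t₁ = s₁ + (Dst : ZMod k₁) := by
    rw [hDst, ZMod.natCast_zmod_val, add_sub_cancel]
  have hmid : t₁ = s₁ + ((Dst / 2 : ℕ) : ZMod k₁) + ((Dst - Dst / 2 : ℕ) : ZMod k₁) := by
    rw [ht, add_assoc, ← Nat.cast_add, Nat.add_sub_cancel' (Nat.div_le_self _ _)]
  have hsq : cycDist s₁ (s₁ + ((Dst / 2 : ℕ) : ZMod k₁)) = Dst / 2 :=
    cycDist_add_natCast hk₁ (by omega) s₁
  have hqt : cycDist (s₁ + ((Dst / 2 : ℕ) : ZMod k₁)) t₁ = Dst - Dst / 2 := by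
    rw [hmid]
    exact cycDist_add_natCast hk₁ (by omega) _
  have hst : cycDist s₁ t₁ = Dst := by
    rw [ht]
    exact cycDist_add_natCast hk₁ (by omega) _
  have hself : cycDist s₂ s₂ = 0 := by simp [cycDist]
  have hup : cycDist s₂ (s₂ + (Δ : ZMod k₂)) = Δ := cycDist_add_natCast hk₂ hΔ s₂
  simp only [torusDist2, cycDist_comm (s₂ + (Δ : ZMod k₂)) s₂, hsq, hqt, hst, hself, hup]
  omega
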